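/- (Unbiasedness of the SURE) Fix λ > 0. Then ∫ SURE(y) dP(y) = ∫ SE(y) dP(y); explicitly, ∫ ( −nσ² + ‖f(y) − y‖₂² + 2σ² m(y) ) dP(y) = ∫ ‖f(y) − μ‖₂² dP(y), i.e. the SURE is an unbiased estimator of the prediction risk of the Lasso fit. -/

import Mathlib

open MeasureTheory ProbabilityTheory

/-- The Lasso objective `F_{y,λ}(x) = (1/2)‖y − Ax‖₂² + λ‖x‖₁`, where the design matrix
`A` has columns `a i`, so `(A x) j = ∑ i, x i * a i j`. -/
noncomputable def lassoObjPi {n p : ℕ} (a : Fin p → Fin n → ℝ) (lam : ℝ)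
    (y : Fin n → ℝ) (x : Fin p → ℝ) : ℝ :=
  (1 / 2) * ∑ j, (y j - ∑ i, x i * a i j) ^ 2 + lam * ∑ i, |x i|

/-- A Lasso solution at `(y, λ)` is a global minimizer of the Lasso objective. -/
def IsLassoSolPi {n p : ℕ} (a : Fin p → Fin n → ℝ) (lam : ℝ)
    (y : Fin n → ℝ) (x : Fin p → ℝ) : Prop :=
  ∀ x' : Fin p → ℝ, lassoObjPi a lam y x ≤ lassoObjPi a lam y x'

/-- The fitted vector `A x`. -/
noncomputable def lFit {n p : ℕ} (a : Fin p → Fin n → ℝ) (x : Fin p → ℝ) : Fin n → ℝ :=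
  fun j => ∑ i, x i * a i j

lemma lFit_add {n p : ℕ} (a : Fin p → Fin n → ℝ) (x y : Fin p → ℝ) (t : ℝ) (j : Fin n) :
    lFit a (fun i => x i + t * y i) j = lFit a x j + t * lFit a y j := by
  simp only [lFit, Finset.mul_sum, ← Finset.sum_add_distrib]
  exact Finset.sum_congr rfl fun i _ => by ring

lemma lFit_dot {n p : ℕ} (a : Fin p → Fin n → ℝ) (x : Fin p → ℝ) (r : Fin n → ℝ) :
    ∑ j, r j * lFit a x j = ∑ i, x i * ∑ j, r j * a i j := by
  simp only [lFit, Finset.mul_sum]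
  rw [Finset.sum_comm]
  exact Finset.sum_congr rfl fun i _ => Finset.sum_congr rfl fun j _ => by ring

/-- Variational inequality for Lasso solutions. -/
lemma lasso_vi {n p : ℕ} (a : Fin p → Fin n → ℝ) (lam : ℝ) (hlam : 0 < lam)
    (z : Fin n → ℝ) (x : Fin p → ℝ) (hx : IsLassoSolPi a lam z x) (d : Fin p → ℝ) :
    ∑ j, (z j - lFit a x j) * lFit a d j ≤ lam * (∑ i, |x i + d i| - ∑ i, |x i|) := by
  set Q := ∑ j, (lFit a d j) ^ 2
  have hQ : 0 ≤ Q := Finset.sum_nonneg fun j _ => sq_nonneg _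
  have key : ∀ t : ℝ, 0 < t → t ≤ 1 →
      ∑ j, (z j - lFit a x j) * lFit a d j
        ≤ lam * (∑ i, |x i + d i| - ∑ i, |x i|) + t * (Q / 2) := by
    intro t ht ht1
    have h := hx (fun i => x i + t * d i)
    unfold lassoObjPi at h
    have e1 : ∑ j, (z j - ∑ i, (x i + t * d i) * a i j) ^ 2
        = ∑ j, (z j - ∑ i, x i * a i j) ^ 2
          - 2 * t * ∑ j, (z j - lFit a x j) * lFit a d j + t ^ 2 * Q := by
      simp only [Q, Finset.mul_sum, ← Finset.sum_add_distrib, ← Finset.sum_sub_distrib]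
      refine Finset.sum_congr rfl fun j _ => ?_
      have := lFit_add a x d t j
      have h2 : ∑ i, (x i + t * d i) * a i j = lFit a (fun i => x i + t * d i) j := rfl
      have h3 : ∑ i, x i * a i j = lFit a x j := rfl
      rw [h2, this, h3]; ring
    have e2 : ∑ i, |x i + t * d i| ≤ (1 - t) * ∑ i, |x i| + t * ∑ i, |x i + d i| := by
      simp only [Finset.mul_sum, ← Finset.sum_add_distrib]
      refine Finset.sum_le_sum fun i _ => ?_
      have : x i + t * d i = (1 - t) * x i + t * (x i + d i) := by ring
      rw [this]
      refine (abs_add_le _ _).trans ?_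
      rw [abs_mul, abs_mul, abs_of_nonneg (by linarith : 0 ≤ 1 - t), abs_of_pos ht]
    rw [e1] at h
    have e3 := mul_le_mul_of_nonneg_left e2 hlam.le
    have : t * (∑ j, (z j - lFit a x j) * lFit a d j)
      ≤ t * (lam * (∑ i, |x i + d i| - ∑ i, |x i|) + t * (Q / 2)) := by nlinarith
    exact le_of_mul_le_mul_left this ht
  refine le_of_forall_pos_le_add fun ε hε => ?_
  have h0 : 0 < min 1 (ε / (Q + 1)) := lt_min one_pos (by positivity)
  refine (key _ h0 (min_le_left _ _)).trans ?_
  gcongr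
  calc min 1 (ε / (Q + 1)) * (Q / 2) ≤ (ε / (Q + 1)) * (Q + 1) := by
        gcongr
        · exact min_le_right _ _
        · linarith
    _ = ε := by field_simp

/-- Stationarity on the support. -/
lemma lasso_kkt {n p : ℕ} (a : Fin p → Fin n → ℝ) (lam : ℝ) (hlam : 0 < lam)
    (z : Fin n → ℝ) (x : Fin p → ℝ) (hx : IsLassoSolPi a lam z x) (i : Fin p) :
    x i * ∑ j, (z j - lFit a x j) * a i j = lam * |x i| := by
  have h := fun c : ℝ => lasso_vi a lam hlam z x hx (Pi.single i (c * x i))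
  have e1 : ∀ c : ℝ, ∑ j, (z j - lFit a x j) * lFit a (Pi.single i (c * x i)) j
      = c * (x i * ∑ j, (z j - lFit a x j) * a i j) := by
    intro c
    rw [lFit_dot, Finset.sum_eq_single i]
    · simp; ring
    · intro k _ hk; simp [hk]
    · simp
  have e2 : ∀ c : ℝ, ∑ k, |x k + (Pi.single i (c * x i) : Fin p → ℝ) k| - ∑ k, |x k|
      = |x i + c * x i| - |x i| := by
    intro c
    rw [← Finset.sum_sub_distrib, Finset.sum_eq_single i]
    · simp
    · intro k _ hk; simp [hk]
    · simp
  have h1 := h 1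
  have h2 := h (-1)
  rw [e1, e2] at h1 h2
  have h3 : |x i + 1 * x i| = 2 * |x i| := by
    rw [show x i + 1 * x i = 2 * x i by ring, abs_mul]; simp
  have h4 : |x i + -1 * x i| = 0 := by simp
  rw [h3] at h1
  rw [h4] at h2
  linarith

lemma lasso_mono {n p : ℕ} (a : Fin p → Fin n → ℝ) (lam : ℝ) (hlam : 0 < lam)
    (z z' : Fin n → ℝ) (x x' : Fin p → ℝ) (hx : IsLassoSolPi a lam z x)
    (hx' : IsLassoSolPi a lam z' x') :
    ∑ j, (lFit a x j - lFit a x' j) ^ 2 ≤ ∑ j, (lFit a x j - lFit a x' j) * (z j - z' j) := by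
  have h1 := lasso_vi a lam hlam z x hx (fun i => x' i - x i)
  have h2 := lasso_vi a lam hlam z' x' hx' (fun i => x i - x' i)
  have e : ∀ u v : Fin p → ℝ, ∀ j, lFit a (fun i => u i - v i) j = lFit a u j - lFit a v j := by
    intro u v j
    simp only [lFit, ← Finset.sum_sub_distrib]
    exact Finset.sum_congr rfl fun i _ => by ring
  simp only [e, add_sub_cancel] at h1 h2
  have h3 : ∑ j, (z j - lFit a x j) * (lFit a x' j - lFit a x j)
      + ∑ j, (z' j - lFit a x' j) * (lFit a x j - lFit a x' j) ≤ 0 := by linarith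
  rw [← Finset.sum_add_distrib] at h3
  rw [← sub_nonpos, ← Finset.sum_sub_distrib]
  refine le_trans (le_of_eq (Finset.sum_congr rfl fun j _ => ?_)) h3
  ring

lemma lasso_contr {n p : ℕ} (a : Fin p → Fin n → ℝ) (lam : ℝ) (hlam : 0 < lam)
    (z z' : Fin n → ℝ) (x x' : Fin p → ℝ) (hx : IsLassoSolPi a lam z x)
    (hx' : IsLassoSolPi a lam z' x') :
    ∑ j, (lFit a x j - lFit a x' j) ^ 2 ≤ ∑ j, (z j - z' j) ^ 2 := by
  have h := lasso_mono a lam hlam z z' x x' hx hx'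
  have h2 : ∑ j, (lFit a x j - lFit a x' j) * (z j - z' j)
      ≤ (1/2) * ∑ j, (lFit a x j - lFit a x' j) ^ 2 + (1/2) * ∑ j, (z j - z' j) ^ 2 := by
    simp only [Finset.mul_sum, ← Finset.sum_add_distrib]
    refine Finset.sum_le_sum fun j _ => ?_
    nlinarith [sq_nonneg ((lFit a x j - lFit a x' j) - (z j - z' j))]
  linarith

/-- A solution of minimal support has linearly independent active columns. -/
lemma lasso_indep {n p : ℕ} (a : Fin p → Fin n → ℝ) (lam : ℝ) (hlam : 0 < lam)
    (z : Fin n → ℝ) (x : Fin p → ℝ) (hx : IsLassoSolPi a lam z x)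
    (hmin : ∀ x' : Fin p → ℝ, IsLassoSolPi a lam z x' →
      {i | x i ≠ 0}.ncard ≤ {i | x' i ≠ 0}.ncard)
    (c : Fin p → ℝ) (hc : ∀ i, x i = 0 → c i = 0) (hac : ∀ j, lFit a c j = 0) : c = 0 := by
  by_contra hne
  have hne' : ∃ i, c i ≠ 0 := by
    by_contra h; push Not at h; exact hne (funext h)
  obtain ⟨i1, hi1⟩ := hne'
  obtain ⟨i0, hi0, hmin0⟩ := Finset.exists_min_image (Finset.univ.filter fun i => c i ≠ 0)
    (fun i => |x i / c i|) ⟨i1, by simp [hi1]⟩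
  simp only [Finset.mem_filter, Finset.mem_univ, true_and] at hi0 hmin0
  set t := -(x i0 / c i0) with ht
  have habs : ∀ k, |t * c k| ≤ |x k| := by
    intro k
    by_cases hk : c k = 0
    · simp [hk]
    · have := hmin0 k hk
      rw [abs_mul, ht, abs_neg]
      rw [abs_div (x k), le_div_iff₀ (abs_pos.2 hk)] at this
      exact this
  set x' : Fin p → ℝ := fun i => x i + t * c i with hx'
  have hs : ∀ k, |x k + t * c k| * lam
      = |x k| * lam + t * (c k * ∑ j, (z j - lFit a x j) * a k j) := by
    intro k
    have hk := lasso_kkt a lam hlam z x hx k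
    have hb := abs_le.1 (habs k)
    rcases lt_trichotomy (x k) 0 with h | h | h
    · have hv : ∑ j, (z j - lFit a x j) * a k j = -lam := by
        rw [abs_of_neg h] at hk
        exact mul_left_cancel₀ h.ne (by linarith)
      rw [hv, abs_of_neg h]
      rw [abs_of_neg h] at hb
      rw [abs_of_nonpos (by linarith)]; ring
    · simp [h, hc k h]
    · have hv : ∑ j, (z j - lFit a x j) * a k j = lam := by
        rw [abs_of_pos h] at hk
        exact mul_left_cancel₀ h.ne' (by linarith)
      rw [hv, abs_of_pos h]
      rw [abs_of_pos h] at hb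
      rw [abs_of_nonneg (by linarith)]; ring
  have hobj : lassoObjPi a lam z x' = lassoObjPi a lam z x := by
    unfold lassoObjPi
    have e1 : ∀ j, ∑ i, x' i * a i j = ∑ i, x i * a i j := by
      intro j
      have := lFit_add a x c t j
      rw [hac j, mul_zero, add_zero] at this
      exact this
    have e2 : lam * ∑ i, |x' i| = lam * ∑ i, |x i| := by
      rw [mul_comm, Finset.sum_mul, mul_comm, Finset.sum_mul]
      simp only [hx', hs, Finset.sum_add_distrib]
      rw [← Finset.mul_sum, ← lFit_dot]
      simp [hac]
    rw [e2]
    simp only [e1]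
  have hsol : IsLassoSolPi a lam z x' := fun w => hobj.le.trans (hx w)
  have h1 := hmin x' hsol
  have h2 : {i | x' i ≠ 0}.ncard < {i | x i ≠ 0}.ncard := by
    apply Set.ncard_lt_ncard _ (Set.toFinite _)
    refine ⟨?_, ?_⟩
    · intro i hi hxi
      apply hi
      simp [hx', hxi, hc i hxi]
    · intro hsub
      have : x' i0 ≠ 0 := hsub (fun h => hi0 (hc i0 h))
      apply this
      simp only [hx', ht]
      field_simp
      ring
  omega

lemma pi_ac : ∀ (n : ℕ) (μ ν : Fin n → Measure ℝ) [∀ i, IsProbabilityMeasure (μ i)]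
    [∀ i, SigmaFinite (ν i)], (∀ i, μ i ≪ ν i) → Measure.pi μ ≪ Measure.pi ν := by
  intro n
  induction n with
  | zero =>
    intro μ ν _ _ _
    rw [Measure.pi_of_empty μ, Measure.pi_of_empty ν]
  | succ n ih =>
    intro μ ν _ _ h
    have h1 := (measurePreserving_piFinSuccAbove μ 0).symm
    have h2 := (measurePreserving_piFinSuccAbove ν 0).symm
    rw [← h1.map_eq, ← h2.map_eq]
    refine Measure.AbsolutelyContinuous.map ?_ (MeasurableEquiv.measurable _)
    exact (h 0).prod (ih _ _ fun i => h _)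

/-- Gaussian integrability of exponentials of the centered absolute value. -/
lemma integrable_exp_abs_gauss (m : ℝ) (v : NNReal) (c : ℝ) :
    Integrable (fun x => Real.exp (c * |x - m|)) (gaussianReal m v) := by
  have h1 : Integrable (fun x => Real.exp (c * x)) (gaussianReal m v) :=
    integrable_exp_mul_gaussianReal c
  have h2 : Integrable (fun x => Real.exp (-c * x)) (gaussianReal m v) :=
    integrable_exp_mul_gaussianReal (-c)
  refine ((h1.const_mul (Real.exp (-c * m))).add (h2.const_mul (Real.exp (c * m)))).mono'
    (by fun_prop) (Filter.Eventually.of_forall fun x => ?_)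
  simp only [Pi.add_apply, ← Real.exp_add]
  rw [Real.norm_of_nonneg (Real.exp_pos _).le]
  rcases abs_cases (x - m) with ⟨h, _⟩ | ⟨h, _⟩
  · rw [h, show c * (x - m) = -c * m + c * x by ring]
    linarith [Real.exp_pos (c * m + -c * x)]
  · rw [h, show c * -(x - m) = c * m + -c * x by ring]
    linarith [Real.exp_pos (-c * m + c * x)]

lemma stein_one (m : ℝ) (v : NNReal) (hv : v ≠ 0) (g : ℝ → ℝ) (K : NNReal)
    (hg : LipschitzWith K g) :
    ∫ x, g x * (x - m) ∂(gaussianReal m v) = v * ∫ x, deriv g x ∂(gaussianReal m v) := by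
  have hv0 : (0 : ℝ) < v := by positivity
  have hgc : Continuous g := hg.continuous
  have hgm : Measurable g := hgc.measurable
  have hgb : ∀ x, |g x| ≤ (|g m| + K) * Real.exp (|x - m|) := by
    intro x
    have h1 := hg.dist_le_mul x m
    rw [Real.dist_eq, Real.dist_eq] at h1
    have h2 : |g x| ≤ |g m| + K * |x - m| := by
      have := abs_add_le (g x - g m) (g m)
      rw [sub_add_cancel] at this; linarith
    have h3 : |x - m| ≤ Real.exp |x - m| := by linarith [Real.add_one_le_exp |x - m|]
    have h4 : 1 ≤ Real.exp |x - m| := Real.one_le_exp (abs_nonneg _)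
    have h5 : (0 : ℝ) ≤ K := K.2
    nlinarith [abs_nonneg (g m), mul_le_mul_of_nonneg_left h3 h5,
      mul_le_mul_of_nonneg_left h4 (abs_nonneg (g m))]
  have hgi : Integrable g (gaussianReal m v) := by
    refine ((integrable_exp_abs_gauss m v 1).const_mul (|g m| + K)).mono'
      hgm.aestronglyMeasurable (Filter.Eventually.of_forall fun x => ?_)
    simpa using hgb x
  have hd1 : HasDerivAt (fun t => ∫ x, g (x + t) ∂(gaussianReal m v))
      (∫ x, deriv g x ∂(gaussianReal m v)) 0 := by
    refine (hasDerivAt_integral_of_dominated_loc_of_lip (F := fun t x => g (x + t))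
      (F' := fun x => deriv g x) (bound := fun _ => (K : ℝ))
      (s := Set.univ) Filter.univ_mem ?_ ?_ ?_ ?_ ?_ ?_).2
    · exact Filter.Eventually.of_forall fun t => by fun_prop
    · simpa using hgi
    · exact (measurable_deriv g).aestronglyMeasurable
    · refine Filter.Eventually.of_forall fun x => ?_
      have : LipschitzWith K (fun t => g (x + t)) := by
        refine LipschitzWith.of_dist_le_mul fun s t => ?_
        have := hg.dist_le_mul (x + s) (x + t)
        simpa using this
      have hK : Real.nnabs (K : ℝ) = K := by ext; simp
      rw [hK]
      exact this.lipschitzOnWith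
    · exact integrable_const _
    · have hae : ∀ᵐ x ∂(volume : Measure ℝ), DifferentiableAt ℝ g x := hg.ae_differentiableAt
      filter_upwards [(gaussianReal_absolutelyContinuous m hv).ae_le hae] with x hx
      have h := hx.hasDerivAt
      have h' : HasDerivAt g (deriv g x) (x + 0) := by simpa using h
      exact h'.comp_const_add x 0
  set W : ℝ → ℝ → ℝ := fun t x => Real.exp (t * (x - m) / v - t ^ 2 / (2 * v)) with hW
  have htr : ∀ t, ∫ x, g (x + t) ∂(gaussianReal m v) = ∫ x, g x * W t x ∂(gaussianReal m v) := by
    intro t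
    have h1 : ∫ x, g (x + t) ∂(gaussianReal m v) = ∫ x, g x ∂(gaussianReal (m + t) v) := by
      rw [← gaussianReal_map_add_const t, integral_map (by fun_prop) hgm.aestronglyMeasurable]
    rw [h1, integral_gaussianReal_eq_integral_smul hv, integral_gaussianReal_eq_integral_smul hv]
    congr 1
    ext x
    simp only [smul_eq_mul, gaussianPDFReal, hW]
    have : Real.exp (-(x - (m + t)) ^ 2 / (2 * v))
        = Real.exp (-(x - m) ^ 2 / (2 * v)) * Real.exp (t * (x - m) / v - t ^ 2 / (2 * v)) := by
      rw [← Real.exp_add]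
      congr 1
      field_simp
      ring
    rw [this]; ring
  have hd2 : HasDerivAt (fun t => ∫ x, g x * W t x ∂(gaussianReal m v))
      (∫ x, g x * (((x - m) / v - 0 / v) * W 0 x) ∂(gaussianReal m v)) 0 := by
    refine (hasDerivAt_integral_of_dominated_loc_of_deriv_le (F := fun t x => g x * W t x)
      (F' := fun t x => g x * (((x - m) / v - t / v) * W t x))
      (bound := fun x => (|g m| + K) / v * Real.exp ((2 + 1 / v) * |x - m|))
      (s := Metric.ball 0 1) (Metric.ball_mem_nhds _ one_pos) ?_ ?_ ?_ ?_ ?_ ?_).2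
    · exact Filter.Eventually.of_forall fun t => by simp only [hW]; fun_prop
    · simpa [hW] using hgi
    · simp only [hW]; fun_prop
    · refine Filter.Eventually.of_forall fun x t ht => ?_
      have ht1 : |t| ≤ 1 := by simpa using (mem_ball_zero_iff.1 ht).le
      rw [norm_mul, norm_mul, Real.norm_eq_abs, Real.norm_eq_abs, Real.norm_eq_abs]
      have e1 : |W t x| ≤ Real.exp (1 / v * |x - m|) := by
        simp only [hW]
        rw [abs_of_pos (Real.exp_pos _), Real.exp_le_exp]
        have : t * (x - m) ≤ |x - m| := by
          refine (le_abs_self _).trans ?_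
          rw [abs_mul]
          nlinarith [abs_nonneg (x - m)]
        have h6 : 0 ≤ t ^ 2 / (2 * v) := by positivity
        have h7 : t * (x - m) / v ≤ |x - m| / v := by gcongr
        have h8 : 1 / v * |x - m| = |x - m| / v := by ring
        linarith
      have e2 : |(x - m) / v - t / v| ≤ 1 / v * Real.exp |x - m| := by
        rw [← sub_div, abs_div, abs_of_pos hv0, div_eq_inv_mul, one_div]
        gcongr
        have := abs_sub (x - m) t
        linarith [Real.add_one_le_exp |x - m|]
      calc |g x| * (|(x - m) / v - t / v| * |W t x|)
          ≤ ((|g m| + K) * Real.exp (|x - m|)) *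
              ((1 / v * Real.exp |x - m|) * Real.exp (1 / v * |x - m|)) := by
            gcongr
            exact hgb x
        _ = (|g m| + K) / v * Real.exp ((2 + 1 / v) * |x - m|) := by
            rw [show (2 + 1 / (v : ℝ)) * |x - m| = |x - m| + |x - m| + 1 / v * |x - m| by ring,
              Real.exp_add, Real.exp_add]
            ring
    · exact (integrable_exp_abs_gauss m v _).const_mul _
    · refine Filter.Eventually.of_forall fun x t _ => ?_
      refine HasDerivAt.const_mul _ ?_
      have h1 : HasDerivAt (fun t : ℝ => t * (x - m) / v - t ^ 2 / (2 * v))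
          ((x - m) / v - t / v) t := by
        have h2 := ((hasDerivAt_id t).mul_const (x - m)).div_const (v : ℝ)
        have h3 := ((hasDerivAt_id t).pow 2).div_const (2 * (v : ℝ))
        refine (h2.sub h3).congr_deriv ?_
        simp only [id_eq]
        field_simp
        norm_num
        ring
      exact h1.exp.congr_deriv (mul_comm _ _)
  simp only [htr] at hd1
  have := hd1.unique hd2
  rw [this, ← integral_const_mul]
  congr 1
  ext x
  simp [hW]
  field_simp

lemma memLp_coord {n : ℕ} (μ : Fin n → ℝ) (v : NNReal) (j : Fin n) :
    MemLp (fun y : Fin n → ℝ => y j) 2 (Measure.pi fun j => gaussianReal (μ j) v) := by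
  have h : MemLp id 2 (gaussianReal (μ j) v) := memLp_id_gaussianReal' 2 (by simp)
  exact h.comp_measurePreserving (measurePreserving_eval (fun j => gaussianReal (μ j) v) j)

lemma memLp_lip {n : ℕ} (μ : Fin n → ℝ) (v : NNReal) (g : (Fin n → ℝ) → ℝ) (K : NNReal)
    (hg : LipschitzWith K g) :
    MemLp g 2 (Measure.pi fun j => gaussianReal (μ j) v) := by
  have h1 : MemLp (fun y : Fin n → ℝ => |g 0| + K * ∑ j, |y j|) 2
      (Measure.pi fun j => gaussianReal (μ j) v) := by
    have h2 : MemLp (fun y : Fin n → ℝ => ∑ j, |y j|) 2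
        (Measure.pi fun j => gaussianReal (μ j) v) :=
      memLp_finsetSum _ fun j _ => (memLp_coord μ v j).abs
    have h3 : MemLp (fun y : Fin n → ℝ => K * ∑ j, |y j|) 2
        (Measure.pi fun j => gaussianReal (μ j) v) := h2.const_mul (K : ℝ)
    have h4 : MemLp (fun _ : Fin n → ℝ => |g 0|) 2
        (Measure.pi fun j => gaussianReal (μ j) v) := memLp_const _
    exact h4.add h3
  refine h1.mono hg.continuous.aestronglyMeasurable (Filter.Eventually.of_forall fun y => ?_)
  have h2 := hg.dist_le_mul y 0
  rw [Real.dist_eq, dist_zero_right] at h2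
  have h3 : ‖y‖ ≤ ∑ j, |y j| := by
    rw [pi_norm_le_iff_of_nonneg (Finset.sum_nonneg fun _ _ => abs_nonneg _)]
    intro i
    exact Finset.single_le_sum (f := fun j => |y j|) (fun _ _ => abs_nonneg _) (Finset.mem_univ i)
  have h4 := mul_le_mul_of_nonneg_left h3 K.2
  have := abs_add_le (g y - g 0) (g 0)
  rw [sub_add_cancel] at this
  rw [Real.norm_eq_abs]
  refine le_trans ?_ (le_abs_self _)
  simp only [NNReal.val_eq_coe] at h4
  linarith

lemma stein_pi {n : ℕ} (μ : Fin n → ℝ) (v : NNReal) (hv : v ≠ 0) (g : (Fin n → ℝ) → ℝ)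
    (K : NNReal) (hg : LipschitzWith K g) (j : Fin n) :
    Integrable (fun y => lineDeriv ℝ g y (Pi.single j 1))
      (Measure.pi fun j => gaussianReal (μ j) v) ∧
    ∫ y, g y * (y j - μ j) ∂(Measure.pi fun j => gaussianReal (μ j) v)
      = v * ∫ y, lineDeriv ℝ g y (Pi.single j 1) ∂(Measure.pi fun j => gaussianReal (μ j) v) := by
  have hli : Integrable (fun y => lineDeriv ℝ g y (Pi.single j 1))
      (Measure.pi fun j => gaussianReal (μ j) v) := by
    refine (integrable_const (K * ‖(Pi.single j 1 : Fin n → ℝ)‖)).mono'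
      (measurable_lineDeriv hg.continuous).aestronglyMeasurable
      (Filter.Eventually.of_forall fun y => norm_lineDeriv_le_of_lipschitz ℝ hg)
  refine ⟨hli, ?_⟩
  have hgi : Integrable (fun y => g y * (y j - μ j))
      (Measure.pi fun j => gaussianReal (μ j) v) :=
    (memLp_lip μ v g K hg).integrable_mul ((memLp_coord μ v j).sub (memLp_const _))
  obtain _ | n := n
  · exact j.elim0
  have hmp := (measurePreserving_piFinSuccAbove (fun j => gaussianReal (μ j) v) j).symm
  have hemb := (MeasurableEquiv.piFinSuccAbove (fun _ : Fin (n+1) => ℝ) j).symm.measurableEmbedding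
  rw [← hmp.integral_comp hemb, ← hmp.integral_comp hemb]
  have hi1 := integral_prod_symm _ (hmp.integrable_comp_of_integrable hgi)
  have hi2 := integral_prod_symm _ (hmp.integrable_comp_of_integrable hli)
  simp only [Function.comp_def] at hi1 hi2
  rw [hi1, hi2, ← integral_const_mul]
  congr 1
  ext w
  have hsl : LipschitzWith K (fun t : ℝ => g (j.insertNth t w)) := by
    refine LipschitzWith.of_dist_le_mul fun s t => ?_
    refine (hg.dist_le_mul _ _).trans ?_
    gcongr
    rw [dist_pi_le_iff dist_nonneg]
    intro i
    refine Fin.succAboveCases j ?_ (fun k => ?_) i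
    · simp
    · simp
  have h := stein_one (μ j) v hv (fun t => g (j.insertNth t w)) K hsl
  have e1 : ∀ t : ℝ, lineDeriv ℝ g (j.insertNth t w) (Pi.single j 1)
      = deriv (fun t : ℝ => g (j.insertNth t w)) t := by
    intro t
    unfold lineDeriv
    have e2 : (fun s : ℝ => g ((j.insertNth t w : Fin (n+1) → ℝ) + s • (Pi.single j 1 : Fin (n+1) → ℝ)))
        = fun s => (fun t : ℝ => g (j.insertNth t w)) (t + s) := by
      ext s
      congr 1
      ext i
      refine Fin.succAboveCases j ?_ (fun k => ?_) i
      · simp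
      · simp [Fin.succAbove_ne]
    rw [e2, deriv_comp_const_add (fun t : ℝ => g (j.insertNth t w)) t 0]
    simp
  have e3 : ∀ t : ℝ, (MeasurableEquiv.piFinSuccAbove (fun _ : Fin (n+1) => ℝ) j).symm (t, w)
      = (j.insertNth t w : Fin (n+1) → ℝ) := fun t => rfl
  simp only [e3, e1, Fin.insertNth_apply_same]
  exact h

/-- The submatrix of active columns. -/
def actMat {n p : ℕ} (a : Fin p → Fin n → ℝ) (S : Finset (Fin p)) : Matrix (Fin n) S ℝ :=
  Matrix.of fun j i => a i j

/-- The projection matrix onto the span of the active columns. -/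
noncomputable def projMat {n p : ℕ} (a : Fin p → Fin n → ℝ) (S : Finset (Fin p)) :
    Matrix (Fin n) (Fin n) ℝ :=
  actMat a S * ((actMat a S).transpose * actMat a S)⁻¹ * (actMat a S).transpose

lemma gram_isUnit {n p : ℕ} (a : Fin p → Fin n → ℝ) (S : Finset (Fin p))
    (h : Function.Injective (actMat a S).mulVec) :
    IsUnit ((actMat a S).transpose * actMat a S).det := by
  have := (Matrix.PosDef.conjTranspose_mul_self (actMat a S) h).det_pos
  rw [Matrix.conjTranspose_eq_transpose_of_trivial] at this
  exact this.ne'.isUnit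

lemma projMat_trace {n p : ℕ} (a : Fin p → Fin n → ℝ) (S : Finset (Fin p))
    (h : Function.Injective (actMat a S).mulVec) : (projMat a S).trace = S.card := by
  unfold projMat
  rw [Matrix.trace_mul_comm, ← Matrix.mul_assoc, Matrix.mul_nonsing_inv _ (gram_isUnit a S h)]
  simp

/-- The affine offset. -/
noncomputable def offVec {n p : ℕ} (a : Fin p → Fin n → ℝ) (lam : ℝ) (S : Finset (Fin p))
    (s : Fin p → SignType) : Fin n → ℝ :=
  (actMat a S * ((actMat a S).transpose * actMat a S)⁻¹).mulVec
    (fun i : S => lam * ((s i : SignType) : ℝ))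

lemma lFit_eq_actMat {n p : ℕ} (a : Fin p → Fin n → ℝ) (S : Finset (Fin p)) (x : Fin p → ℝ)
    (hx : ∀ i, i ∉ S → x i = 0) : lFit a x = (actMat a S).mulVec (fun i : S => x i) := by
  ext j
  simp only [lFit, Matrix.mulVec, dotProduct, actMat, Matrix.of_apply]
  rw [Finset.sum_coe_sort S (fun i => a i j * x i)]
  rw [← Finset.sum_subset (Finset.subset_univ S)]
  · exact Finset.sum_congr rfl fun i _ => mul_comm _ _
  · intro i _ hi; simp [hx i hi]

lemma fit_affine {n p : ℕ} (a : Fin p → Fin n → ℝ) (lam : ℝ) (hlam : 0 < lam)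
    (z : Fin n → ℝ) (x : Fin p → ℝ) (hx : IsLassoSolPi a lam z x) (S : Finset (Fin p))
    (hS : ∀ i, i ∈ S ↔ x i ≠ 0) (h : Function.Injective (actMat a S).mulVec) :
    lFit a x = (projMat a S).mulVec z - offVec a lam S (fun i => SignType.sign (x i)) := by
  have e := lFit_eq_actMat a S x (fun i hi => by by_contra hne; exact hi ((hS i).2 hne))
  have hk : (actMat a S).transpose.mulVec (z - lFit a x)
      = fun i : S => lam * ((SignType.sign (x i) : SignType) : ℝ) := by
    ext i
    have h1 := lasso_kkt a lam hlam z x hx i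
    have hi : x i ≠ 0 := (hS i).1 i.2
    have h2 : (actMat a S).transpose.mulVec (z - lFit a x) i
        = ∑ j, (z j - lFit a x j) * a i j := by
      simp only [Matrix.mulVec, dotProduct, actMat, Matrix.transpose_apply, Matrix.of_apply,
        Pi.sub_apply]
      exact Finset.sum_congr rfl fun j _ => mul_comm _ _
    rw [h2]
    refine mul_left_cancel₀ hi ?_
    rw [h1]
    have := self_mul_sign (x i)
    rw [← this]; ring
  unfold offVec projMat
  rw [← hk, Matrix.mulVec_mulVec, ← Matrix.mulVec_sub]
  rw [sub_sub_cancel]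
  nth_rewrite 2 [e]
  rw [Matrix.mulVec_mulVec, Matrix.mul_assoc, Matrix.mul_assoc,
    Matrix.nonsing_inv_mul _ (gram_isUnit a S h), Matrix.mul_one]
  exact e

lemma indep_inj {n p : ℕ} (a : Fin p → Fin n → ℝ) (S : Finset (Fin p))
    (h : ∀ c : Fin p → ℝ, (∀ i, i ∉ S → c i = 0) → (∀ j, lFit a c j = 0) → c = 0) :
    Function.Injective (actMat a S).mulVec := by
  have hinj : Function.Injective (actMat a S).mulVecLin := by
    rw [injective_iff_map_eq_zero]
    intro w hw
    set c : Fin p → ℝ := fun i => if hi : i ∈ S then w ⟨i, hi⟩ else 0 with hc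
    have hc0 : ∀ i, i ∉ S → c i = 0 := fun i hi => by simp [hc, hi]
    have e : (fun i : S => c i) = w := by ext i; simp [hc]
    have := h c hc0 (fun j => by
      rw [lFit_eq_actMat a S c hc0, e]
      exact congrFun hw j)
    rw [← e, this]; rfl
  exact hinj

lemma ae_div {n p : ℕ} (a : Fin p → Fin n → ℝ) (lam : ℝ) (hlam : 0 < lam)
    (f : (Fin n → ℝ) → Fin n → ℝ) (hfmeas : Measurable f)
    (hf : ∀ z, ∃ x : Fin p → ℝ, IsLassoSolPi a lam z x ∧ f z = lFit a x)
    (m : (Fin n → ℝ) → ℕ) (hmmeas : Measurable m)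
    (hm : ∀ z, IsLeast
      {k : ℕ | ∃ x : Fin p → ℝ, IsLassoSolPi a lam z x ∧ {i | x i ≠ 0}.ncard = k} (m z))
    (K : NNReal) (hK : LipschitzWith K f) :
    ∀ᵐ z ∂(volume : Measure (Fin n → ℝ)),
      ∑ j, lineDeriv ℝ (fun y => f y j) z (Pi.single j 1) = (m z : ℝ) := by
  set E : Finset (Fin p) → (Fin p → SignType) → Set (Fin n → ℝ) := fun S s =>
    {z | f z = (projMat a S).mulVec z - offVec a lam S s} ∩ {z | m z = S.card}
      ∩ {z | DifferentiableAt ℝ f z} with hE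
  have hcont : ∀ S s, Measurable fun z => (projMat a S).mulVec z - offVec a lam S s := by
    intro S s
    have : Continuous fun z => (projMat a S).mulVec z - offVec a lam S s :=
      (Continuous.matrix_mulVec continuous_const continuous_id).sub continuous_const
    exact this.measurable
  have hEm : ∀ S s, MeasurableSet (E S s) := by
    intro S s
    refine ((measurableSet_eq_fun hfmeas (hcont S s)).inter ?_).inter
      (measurableSet_of_differentiableAt ℝ f)
    exact hmmeas (measurableSet_singleton _)
  have hae : ∀ S s, ∀ᵐ z ∂(volume : Measure (Fin n → ℝ)), z ∈ E S s →
      fderiv ℝ f z = LinearMap.toContinuousLinearMap (projMat a S).mulVecLin := by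
    intro S s
    have happ : ApproximatesLinearOn f
        (LinearMap.toContinuousLinearMap (projMat a S).mulVecLin) (E S s) 0 := by
      intro u hu w hw
      have h1 : f u = _ := hu.1.1
      have h2 : f w = _ := hw.1.1
      rw [h1, h2]
      simp [Matrix.mulVec_sub]
    have := happ.norm_fderiv_sub_le volume (hEm S s) (fderiv ℝ f)
      (fun z hz => (hz.2 : DifferentiableAt ℝ f z).hasFDerivAt.hasFDerivWithinAt)
    rw [ae_restrict_iff' (hEm S s)] at this
    filter_upwards [this] with z hz hzE
    have := hz hzE
    simpa [sub_eq_zero] using this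
  have hall : ∀ᵐ z ∂(volume : Measure (Fin n → ℝ)), ∀ S s, z ∈ E S s →
      fderiv ℝ f z = LinearMap.toContinuousLinearMap (projMat a S).mulVecLin := by
    rw [ae_all_iff]
    intro S
    rw [ae_all_iff]
    exact hae S
  filter_upwards [hall, hK.ae_differentiableAt] with z hz hd
  obtain ⟨⟨x, hx, hxm⟩, hmin⟩ := hm z
  obtain ⟨x1, hx1, hfx1⟩ := hf z
  have hfx : f z = lFit a x := by
    have h := lasso_contr a lam hlam z z x1 x hx1 hx
    simp only [sub_self, ne_eq, OfNat.ofNat_ne_zero, not_false_eq_true, zero_pow,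
      Finset.sum_const_zero] at h
    have h2 := (Finset.sum_eq_zero_iff_of_nonneg (fun j _ => sq_nonneg _)).1
      (le_antisymm h (Finset.sum_nonneg fun j _ => sq_nonneg _))
    rw [hfx1]
    ext j
    have := h2 j (Finset.mem_univ j)
    exact sub_eq_zero.1 (pow_eq_zero_iff (two_ne_zero) |>.1 this)
  set S : Finset (Fin p) := Finset.univ.filter fun i => x i ≠ 0 with hS
  have hSi : ∀ i, i ∈ S ↔ x i ≠ 0 := by simp [hS]
  have hcard : m z = S.card := by
    rw [← hxm, ← Set.ncard_coe_finset]
    congr 1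
    ext i; simp [hSi]
  have hinj : Function.Injective (actMat a S).mulVec := by
    refine indep_inj a S fun c hc hac => ?_
    refine lasso_indep a lam hlam z x hx ?_ c (fun i hi => hc i (by simp [hSi, hi])) hac
    intro x' hx'
    rw [hxm]
    exact hmin ⟨x', hx', rfl⟩
  have hmem : z ∈ E S (fun i => SignType.sign (x i)) := by
    refine ⟨⟨?_, hcard⟩, hd⟩
    show f z = _
    rw [hfx]
    exact fit_affine a lam hlam z x hx S hSi hinj
  have hfd := hd.hasFDerivAt
  rw [hz S _ hmem] at hfd
  rw [hcard, ← projMat_trace a S hinj, Matrix.trace]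
  refine Finset.sum_congr rfl fun j _ => ?_
  have h1 := (hasFDerivAt_pi'.1 hfd j).hasLineDerivAt (Pi.single j 1)
  rw [h1.lineDeriv]
  simp

lemma fit_lip {n p : ℕ} (a : Fin p → Fin n → ℝ) (lam : ℝ) (hlam : 0 < lam)
    (f : (Fin n → ℝ) → Fin n → ℝ)
    (hf : ∀ z, ∃ x : Fin p → ℝ, IsLassoSolPi a lam z x ∧ f z = lFit a x) :
    LipschitzWith (Real.toNNReal (Real.sqrt n)) f := by
  refine LipschitzWith.of_dist_le_mul fun z z' => ?_
  rw [Real.coe_toNNReal _ (Real.sqrt_nonneg _)]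
  obtain ⟨x, hx, hfx⟩ := hf z
  obtain ⟨x', hx', hfx'⟩ := hf z'
  have h := lasso_contr a lam hlam z z' x x' hx hx'
  rw [dist_pi_le_iff (by positivity)]
  intro j
  rw [hfx, hfx', Real.dist_eq]
  refine abs_le_of_sq_le_sq ?_ (by positivity)
  rw [mul_pow, Real.sq_sqrt (by positivity)]
  calc (lFit a x j - lFit a x' j) ^ 2 ≤ ∑ j, (lFit a x j - lFit a x' j) ^ 2 :=
        Finset.single_le_sum (f := fun j => (lFit a x j - lFit a x' j) ^ 2)
          (fun _ _ => sq_nonneg _) (Finset.mem_univ j)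
    _ ≤ ∑ j, (z j - z' j) ^ 2 := h
    _ ≤ ∑ _j : Fin n, dist z z' ^ 2 := by
        refine Finset.sum_le_sum fun k _ => ?_
        rw [← sq_abs, ← Real.dist_eq]
        gcongr
        exact dist_le_pi_dist z z' k
    _ = n * dist z z' ^ 2 := by simp

/-- Unbiasedness of the SURE. Fix `λ > 0`, let `μ = A x⁰` and let
`P = N(μ, σ² Id)` on `ℝⁿ`. With `f` the Lasso-fit map and `m` the minimal support size,
`SURE(y) = −nσ² + ‖f(y) − y‖₂² + 2σ² m(y)` satisfies
`∫ SURE(y) dP(y) = ∫ ‖f(y) − μ‖₂² dP(y)`: the SURE is an unbiased estimator of the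
prediction risk of the Lasso fit. -/
theorem lasso_sure_unbiased {n p : ℕ} (a : Fin p → Fin n → ℝ)
    (lam : ℝ) (hlam : 0 < lam) (x0 : Fin p → ℝ) (σ : ℝ) (hσ : 0 < σ)
    (μ : Fin n → ℝ) (hμ : μ = fun j => ∑ i, x0 i * a i j)
    (P : Measure (Fin n → ℝ))
    (hP : P = Measure.pi fun j => gaussianReal (μ j) (Real.toNNReal (σ ^ 2)))
    (f : (Fin n → ℝ) → Fin n → ℝ) (hfmeas : Measurable f)
    (hf : ∀ z, ∃ x : Fin p → ℝ, IsLassoSolPi a lam z x ∧ f z = fun j => ∑ i, x i * a i j)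
    (m : (Fin n → ℝ) → ℕ) (hmmeas : Measurable m)
    (hm : ∀ z, IsLeast
      {k : ℕ | ∃ x : Fin p → ℝ, IsLassoSolPi a lam z x ∧ {i | x i ≠ 0}.ncard = k} (m z)) :
    ∫ y, (-(n : ℝ) * σ ^ 2 + ∑ j, (f y j - y j) ^ 2 + 2 * σ ^ 2 * (m y : ℝ)) ∂P
      = ∫ y, ∑ j, (f y j - μ j) ^ 2 ∂P := by
  have hf' : ∀ z, ∃ x : Fin p → ℝ, IsLassoSolPi a lam z x ∧ f z = lFit a x := hf
  have hK := fit_lip a lam hlam f hf'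
  set K := Real.toNNReal (Real.sqrt n)
  set v := Real.toNNReal (σ ^ 2) with hvdef
  have hvc : (v : ℝ) = σ ^ 2 := Real.coe_toNNReal _ (sq_nonneg σ)
  have hv : v ≠ 0 := by
    intro h
    rw [h] at hvc
    have : 0 < σ ^ 2 := by positivity
    simp at hvc
    linarith
  have hKj : ∀ j, LipschitzWith K (fun y => f y j) := fun j =>
    LipschitzWith.of_dist_le_mul fun y z => (dist_le_pi_dist _ _ j).trans (hK.dist_le_mul y z)
  subst hP
  have hac : (Measure.pi fun j => gaussianReal (μ j) v) ≪ (volume : Measure (Fin n → ℝ)) :=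
    pi_ac n _ _ fun j => gaussianReal_absolutelyContinuous (μ j) hv
  have hdiv : ∀ᵐ z ∂(Measure.pi fun j => gaussianReal (μ j) v),
      ∑ j, lineDeriv ℝ (fun y => f y j) z (Pi.single j 1) = (m z : ℝ) :=
    hac.ae_le (ae_div a lam hlam f hfmeas hf' m hmmeas hm K hK)
  set P := Measure.pi fun j => gaussianReal (μ j) v with hP
  have hst := fun j => stein_pi μ v hv (fun y => f y j) K (hKj j) j
  have hfL : ∀ j, MemLp (fun y => f y j) 2 P := fun j => memLp_lip μ v _ K (hKj j)
  have hyL : ∀ j, MemLp (fun y : Fin n → ℝ => y j) 2 P := fun j => memLp_coord μ v j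
  have hcL : ∀ c : ℝ, MemLp (fun _ : Fin n → ℝ => c) 2 P := fun c => memLp_const c
  have i1 : ∀ j, Integrable (fun y => f y j * (y j - μ j)) P := fun j =>
    (hfL j).integrable_mul ((hyL j).sub (hcL (μ j)))
  have i2 : ∀ j, Integrable (fun y => (f y j - y j) ^ 2) P := fun j =>
    ((hfL j).sub (hyL j)).integrable_sq
  have i3 : ∀ j, Integrable (fun y => (f y j - μ j) ^ 2) P := fun j =>
    ((hfL j).sub (hcL (μ j))).integrable_sq
  have i4 : ∀ j, Integrable (fun y : Fin n → ℝ => (y j - μ j) ^ 2) P := fun j =>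
    ((hyL j).sub (hcL (μ j))).integrable_sq
  have i5 : ∀ j, Integrable (fun y : Fin n → ℝ => y j - μ j) P := fun j =>
    ((hyL j).sub (hcL (μ j))).integrable (by norm_num)
  have hsum : ∫ y, (m y : ℝ) ∂P
      = ∑ j, ∫ y, lineDeriv ℝ (fun y => f y j) y (Pi.single j 1) ∂P := by
    rw [← integral_finsetSum _ fun j _ => (hst j).1]
    exact integral_congr_ae (hdiv.mono fun y hy => hy.symm)
  have im : Integrable (fun y => (m y : ℝ)) P :=
    (integrable_finsetSum _ fun j _ => (hst j).1).congr hdiv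
  have hcross : σ ^ 2 * ∫ y, (m y : ℝ) ∂P = ∑ j, ∫ y, f y j * (y j - μ j) ∂P := by
    rw [hsum, Finset.mul_sum]
    refine Finset.sum_congr rfl fun j _ => ?_
    rw [(hst j).2, hvc]
  have hvar : ∀ j, ∫ y : Fin n → ℝ, (y j - μ j) ^ 2 ∂P = σ ^ 2 := by
    intro j
    have hmp := measurePreserving_eval (fun j => gaussianReal (μ j) v) j
    have h1 : ∫ t, (t - μ j) ^ 2 ∂(gaussianReal (μ j) v) = σ ^ 2 := by
      have h2 := variance_id_gaussianReal (μ := μ j) (v := v)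
      rw [variance_eq_integral (by fun_prop)] at h2
      simpa [hvc] using h2
    rw [← h1, ← hmp.map_eq, integral_map hmp.measurable.aemeasurable (by fun_prop)]
  have hmean : ∀ j, ∫ y : Fin n → ℝ, (y j - μ j) ∂P = 0 := by
    intro j
    have hmp := measurePreserving_eval (fun j => gaussianReal (μ j) v) j
    have h1 : ∫ t, (t - μ j) ∂(gaussianReal (μ j) v) = 0 := by
      have hid : Integrable (fun t : ℝ => t) (gaussianReal (μ j) v) :=
        (memLp_id_gaussianReal' 1 (by simp)).integrable le_rfl
      rw [integral_sub hid (integrable_const _)]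
      simp [integral_id_gaussianReal]
    rw [← h1, ← hmp.map_eq, integral_map hmp.measurable.aemeasurable (by fun_prop)]
  have hkey : ∀ j, ∫ y, (f y j - μ j) ^ 2 ∂P
      = ∫ y, (f y j - y j) ^ 2 ∂P + 2 * ∫ y, f y j * (y j - μ j) ∂P - σ ^ 2 := by
    intro j
    have e : ∀ y : Fin n → ℝ, (f y j - μ j) ^ 2
        = (f y j - y j) ^ 2 + 2 * (f y j * (y j - μ j)) - 2 * μ j * (y j - μ j)
          - (y j - μ j) ^ 2 := fun y => by ring
    simp only [e]
    have k1 : Integrable (fun y => (f y j - y j) ^ 2 + 2 * (f y j * (y j - μ j))) P :=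
      (i2 j).add ((i1 j).const_mul 2)
    have k2 : Integrable (fun y => (f y j - y j) ^ 2 + 2 * (f y j * (y j - μ j))
        - 2 * μ j * (y j - μ j)) P := k1.sub ((i5 j).const_mul _)
    rw [integral_sub k2 (i4 j), integral_sub k1 ((i5 j).const_mul _),
      integral_add (i2 j) ((i1 j).const_mul 2), integral_const_mul, integral_const_mul,
      hvar, hmean]
    ring
  have j1 : Integrable (fun y => ∑ j, (f y j - y j) ^ 2) P :=
    integrable_finsetSum _ fun j _ => i2 j
  have j2 : Integrable (fun y => -(n : ℝ) * σ ^ 2 + ∑ j, (f y j - y j) ^ 2) P :=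
    (integrable_const _).add j1
  rw [integral_add j2 (im.const_mul _),
    integral_add (integrable_const _) j1, integral_const_mul (2 * σ ^ 2), integral_finsetSum _ fun j _ => i2 j,
    integral_finsetSum _ fun j _ => i3 j]
  simp only [hkey, Finset.sum_add_distrib, Finset.sum_sub_distrib, ← Finset.mul_sum, ← hcross]
  simp
  ring
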